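/- Let y ∈ W have minimal length in the double coset W_J y = y W_K. Then for every j ∈ J, y^{-1}·α_j is a positive root lying in the span of {α_k : k ∈ K}, and for every k ∈ K, y·α_k is a positive root lying in the span of {α_j : j ∈ J}. -/

import Mathlib

open CoxeterSystem

/-- `v` is a nonnegative linear combination of the vectors `α b`. -/
def InNonnegSpan {B V : Type*} [AddCommGroup V] [Module ℝ V] (α : B → V) (v : V) : Prop :=
  ∃ c : B →₀ ℝ, (∀ b, 0 ≤ c b) ∧ v = c.sum fun b r => r • α b

/-- The reflection representation of a Coxeter system, axiomatised: a representation `ρ` of `W`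
on a real vector space `V` with linearly independent simple roots `α i` spanning `V`, such that
each simple reflection negates its simple root, every root `w · α i` is positive or negative,
and positivity of `w · α i` is detected by the length function. -/
structure ReflRep {B W : Type*} [Group W] {M : CoxeterMatrix B} (cs : CoxeterSystem M W)
    (V : Type*) [AddCommGroup V] [Module ℝ V] where
  ρ : Representation ℝ W V
  α : B → V
  indep : LinearIndependent ℝ α
  spans : Submodule.span ℝ (Set.range α) = ⊤
  refl_simple : ∀ i : B, ρ (cs.simple i) (α i) = -α i
  root_pos_or_neg : ∀ (w : W) (i : B),
    InNonnegSpan α (ρ w (α i)) ∨ InNonnegSpan α (-(ρ w (α i)))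
  pos_iff_length : ∀ (w : W) (i : B),
    InNonnegSpan α (ρ w (α i)) ↔ cs.length (w * cs.simple i) = cs.length w + 1

/-- The standard parabolic subgroup `W_J`. -/
def parabolic {B W : Type*} [Group W] {M : CoxeterMatrix B} (cs : CoxeterSystem M W)
    (J : Set B) : Subgroup W :=
  Subgroup.closure (cs.simple '' J)

open Polynomial Polynomial.Chebyshev in
theorem aux_coef (m : ℕ) (hm : 3 ≤ m) (t : ℝ) (ht : t = 2 * Real.cos (2 * Real.pi / m)) :
    ((S ℝ (((m:ℤ) - 2) / 2)).eval t * ((S ℝ (((m:ℤ) - 1) / 2)).eval t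
      + (S ℝ (((m:ℤ) - 3) / 2)).eval t)) = 0 ∧
    ((S ℝ (((m:ℤ) - 1) / 2)).eval t * ((S ℝ ((m:ℤ) / 2)).eval t
      + (S ℝ (((m:ℤ) - 2) / 2)).eval t)) = 0 := by
  have hm' : (3:ℝ) ≤ m := by exact_mod_cast hm
  have hs : Real.sin (2 * Real.pi / m) ≠ 0 := by
    apply ne_of_gt
    apply Real.sin_pos_of_pos_of_lt_pi
    · have := Real.pi_pos; positivity
    · rw [div_lt_iff₀ (by linarith)]
      nlinarith [Real.pi_pos]
  have key := fun n : ℤ => S_two_mul_real_cos (2 * Real.pi / m) n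
  rw [← ht] at key
  have hm0 : (m:ℝ) ≠ 0 := by linarith
  rcases Nat.even_or_odd' m with ⟨k, hk | hk⟩
  · have h1 : ((m:ℤ) - 2) / 2 = k - 1 := by omega
    have h2 : ((m:ℤ) - 1) / 2 = k - 1 := by omega
    have h0 : (S ℝ ((k:ℤ) - 1)).eval t = 0 := by
      have := key (k - 1)
      have e : (((k:ℤ) - 1 : ℤ) + 1 : ℝ) * (2 * Real.pi / m) = Real.pi := by
        push_cast; rw [hk] at hm0 ⊢; push_cast at hm0 ⊢
        have hk0 : (k:ℝ) ≠ 0 := fun h => hm0 (by rw [h]; simp)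
        field_simp; ring
      rw [e, Real.sin_pi] at this
      exact (mul_eq_zero.1 this).resolve_right hs
    rw [h1, h2, h0]; simp
  · have h1 : ((m:ℤ) - 2) / 2 = k - 1 := by omega
    have h2 : ((m:ℤ) - 1) / 2 = k := by omega
    have h3 : ((m:ℤ) - 3) / 2 = k - 1 := by omega
    have h4 : ((m:ℤ)) / 2 = k := by omega
    have h0 : (S ℝ ((k:ℤ))).eval t + (S ℝ ((k:ℤ) - 1)).eval t = 0 := by
      have a := key (k - 1)
      have b := key k
      have e : ((k:ℤ) + 1 : ℝ) * (2 * Real.pi / m) =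
          2 * Real.pi - (((k:ℤ) - 1 : ℤ) + 1 : ℝ) * (2 * Real.pi / m) := by
        push_cast; rw [hk] at hm0 ⊢; push_cast at hm0 ⊢; field_simp; ring
      rw [e, Real.sin_two_pi_sub, ← a] at b
      have : ((S ℝ ((k:ℤ))).eval t + (S ℝ ((k:ℤ) - 1)).eval t) * Real.sin (2 * Real.pi / m) = 0 := by
        linarith
      exact (mul_eq_zero.1 this).resolve_right hs
    rw [h1, h2, h3, h4, h0]; simp

theorem aux_simple_injective {B W : Type*} [Group W] {M : CoxeterMatrix B}
    (cs : CoxeterSystem M W) : Function.Injective cs.simple := by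
  classical
  let f : B → Module.Dual ℝ (B →₀ ℝ) := fun i =>
    Finsupp.linearCombination ℝ (fun j => -2 * Real.cos (Real.pi / M i j))
  let x : B → (B →₀ ℝ) := fun i => Finsupp.single i 1
  have hfx : ∀ i j, f i (x j) = -2 * Real.cos (Real.pi / M i j) := by
    intro i j; simp [f, x]
  have h2 : ∀ i, f i (x i) = 2 := by intro i; rw [hfx]; simp
  have hl : M.IsLiftable (fun i => Module.reflection (h2 i)) := by
    intro i j
    by_cases hij : i = j
    · subst hij
      simp only [M.diagonal, pow_one]
      ext1 z
      exact Module.involutive_reflection (h2 i) z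
    have h1 : M i j ≠ 1 := M.off_diagonal i j hij
    have hsym : M j i = M i j := M.symmetric j i
    rcases Nat.lt_or_ge (M i j) 3 with hlt | hge
    · have : M i j = 0 ∨ M i j = 2 := by omega
      rcases this with h | h
      · rw [h, pow_zero]
      · have a : f i (x j) = 0 := by rw [hfx, h]; simp
        have b : f j (x i) = 0 := by rw [hfx, hsym, h]; simp
        rw [h, pow_two]
        ext1 z
        simp only [LinearEquiv.mul_apply, Module.reflection_apply, map_sub, map_smul, a, b, h2,
          LinearEquiv.coe_one, id]
        simp
        try module
    · ext1 z
      have ht : (2 * Real.cos (2 * Real.pi / (M i j))) = f i (x j) * f j (x i) - 2 := by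
        rw [hfx, hfx, hsym, mul_div_assoc, Real.cos_two_mul]; ring
      rw [Module.reflection_mul_reflection_pow_apply (h2 i) (h2 j) (M i j) z _ ht,
        (aux_coef _ hge _ rfl).1, (aux_coef _ hge _ rfl).2]
      simp
  intro i j hij
  by_contra hne
  have h := congrArg (cs.lift ⟨_, hl⟩) hij
  rw [cs.lift_apply_simple, cs.lift_apply_simple] at h
  have h' := congrArg (fun g : (B →₀ ℝ) ≃ₗ[ℝ] (B →₀ ℝ) => g (x i) i) h
  simp only [Module.reflection_apply, h2] at h'
  simp [x, Ne.symm hne] at h'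

section exch
variable {B W : Type*} [Group W] {M : CoxeterMatrix B} (cs : CoxeterSystem M W)

open Classical in
noncomputable def auxE (i : B) : Function.End (W × ZMod 2) :=
  fun p => (cs.simple i * p.1 * cs.simple i, p.2 + if p.1 = cs.simple i then 1 else 0)

theorem aux_comm (i j : B) (n : ℕ) : (cs.simple j * cs.simple i) ^ n * cs.simple j *
    (cs.simple j * cs.simple i) ^ n = cs.simple j := by
  induction n with
  | zero => simp
  | succ n ih =>
    rw [pow_succ']
    nth_rewrite 2 [← pow_succ']
    rw [pow_succ]
    calc _ = cs.simple j * cs.simple i * ((cs.simple j * cs.simple i) ^ n * cs.simple j *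
    (cs.simple j * cs.simple i) ^ n) * (cs.simple j * cs.simple i) := by simp only [mul_assoc]
      _ = _ := by rw [ih]; simp [mul_assoc]

open Classical in
theorem aux_pow (i j : B) (n : ℕ) (t : W) (ε : ZMod 2) :
    ((auxE cs i * auxE cs j) ^ n) (t, ε) =
      (((cs.simple j * cs.simple i) ^ n)⁻¹ * t * (cs.simple j * cs.simple i) ^ n,
        ε + ∑ p ∈ Finset.range (2 * n),
          if t = (cs.simple j * cs.simple i) ^ p * cs.simple j then 1 else 0) := by
  induction n with
  | zero => simp; rfl
  | succ n ih =>
    rw [pow_succ']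
    change (auxE cs i) ((auxE cs j) (((auxE cs i * auxE cs j) ^ n) (t, ε))) = _
    rw [ih]
    set r := cs.simple j * cs.simple i with hr
    have hc := aux_comm cs i j n
    rw [← hr] at hc
    have hri : r⁻¹ = cs.simple i * cs.simple j := by simp [hr]
    have hc' : r ^ n * cs.simple j * (r ^ n)⁻¹ = r ^ (2 * n) * cs.simple j := by
      rw [mul_inv_eq_iff_eq_mul, two_mul, pow_add, mul_assoc, mul_assoc]
      congr 1
      rw [← mul_assoc, hc]
    have c1 : ((r ^ n)⁻¹ * t * r ^ n = cs.simple j) ↔ t = r ^ (2 * n) * cs.simple j := by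
      rw [← hc']
      constructor
      · intro h; rw [← h]; group
      · intro h; rw [h]; group
    have c2 : (cs.simple j * ((r ^ n)⁻¹ * t * r ^ n) * cs.simple j = cs.simple i) ↔
        t = r ^ (2 * n + 1) * cs.simple j := by
      have : r ^ (2 * n + 1) * cs.simple j = r ^ n * (cs.simple j * cs.simple i * cs.simple j) * (r ^ n)⁻¹ := by
        rw [pow_succ', mul_assoc, ← hc', ← hr]
        rw [← mul_assoc, ← mul_assoc, ← mul_assoc, ← pow_succ', pow_succ]
      rw [this]
      constructor
      · intro h; rw [← h]; simp [mul_assoc]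
      · intro h; rw [h]; simp [mul_assoc]
    simp only [auxE, c1, c2]
    rw [show 2 * (n + 1) = 2 * n + 1 + 1 by ring, Finset.sum_range_succ, Finset.sum_range_succ]
    refine Prod.ext ?_ ?_
    · simp only [pow_succ, mul_inv_rev, hri]; rw [hr]; simp only [mul_assoc]
    · simp only [add_assoc]

theorem aux_liftable : M.IsLiftable (auxE cs) := by
  classical
  intro i j
  funext ⟨t, ε⟩
  rw [aux_pow]
  have hm : (cs.simple j * cs.simple i) ^ M i j = 1 := by
    rw [M.symmetric i j]; exact cs.simple_mul_simple_pow j i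
  rw [hm, two_mul, Finset.sum_range_add]
  simp only [pow_add, hm, one_mul]
  rw [CharTwo.add_self_eq_zero]
  simp; rfl

open Classical in
theorem aux_word (ω : List B) (t : W) (ε : ZMod 2) :
    cs.lift ⟨auxE cs, aux_liftable cs⟩ (cs.wordProd ω) (t, ε) =
      (cs.wordProd ω * t * (cs.wordProd ω)⁻¹, ε + ((cs.rightInvSeq ω).count t : ZMod 2)) := by
  induction ω with
  | nil => simp; rfl
  | cons i ω ih =>
    rw [cs.wordProd_cons, map_mul, cs.lift_apply_simple]
    change auxE cs i (cs.lift ⟨auxE cs, aux_liftable cs⟩ (cs.wordProd ω) (t, ε)) = _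
    rw [ih]
    have : (cs.wordProd ω * t * (cs.wordProd ω)⁻¹ = cs.simple i) ↔
      ((cs.wordProd ω)⁻¹ * cs.simple i * cs.wordProd ω = t) := by
      constructor
      · intro h; rw [← h]; group
      · intro h; rw [← h]; group
    simp only [auxE, this, CoxeterSystem.rightInvSeq, List.count_cons, beq_iff_eq]
    refine Prod.ext ?_ ?_
    · simp [mul_assoc]
    · simp only [add_assoc]; split_ifs <;> simp

noncomputable def auxN (w t : W) : ZMod 2 := (cs.lift ⟨auxE cs, aux_liftable cs⟩ w (t, 0)).2

theorem aux_act (w t : W) (ε : ZMod 2) : cs.lift ⟨auxE cs, aux_liftable cs⟩ w (t, ε) =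
    (w * t * w⁻¹, ε + auxN cs w t) := by
  obtain ⟨ω, rfl⟩ := cs.wordProd_surjective w
  rw [auxN, aux_word, aux_word]; simp

theorem auxN_mul (w w' t : W) : auxN cs (w * w') t = auxN cs w' t + auxN cs w (w' * t * w'⁻¹) := by
  rw [auxN, map_mul]
  change (cs.lift ⟨auxE cs, aux_liftable cs⟩ w (cs.lift ⟨auxE cs, aux_liftable cs⟩ w' (t, 0))).2 = _
  rw [aux_act, aux_act]; simp

theorem auxN_simple (i : B) : auxN cs (cs.simple i) (cs.simple i) = 1 := by
  rw [auxN, cs.lift_apply_simple]; simp [auxE]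

theorem auxN_zero_or (z : ZMod 2) : z = 0 ∨ z = 1 := by revert z; decide

theorem aux_mem (ω : List B) (t : W) (h : auxN cs (cs.wordProd ω) t = 1) :
    t ∈ cs.rightInvSeq ω := by
  classical
  rw [auxN, aux_word] at h
  by_contra hn
  rw [List.count_eq_zero_of_not_mem hn] at h
  simp at h

theorem aux_exchange (ω : List B) (i : B)
    (h : cs.length (cs.wordProd ω * cs.simple i) < cs.length (cs.wordProd ω)) :
    ∃ p < ω.length, cs.wordProd ω * cs.simple i = cs.wordProd (ω.eraseIdx p) := by
  have h1 : auxN cs (cs.wordProd ω) (cs.simple i) = 1 := by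
    rcases auxN_zero_or (auxN cs (cs.wordProd ω) (cs.simple i)) with h0 | h0
    · exfalso
      have : auxN cs (cs.wordProd ω * cs.simple i) (cs.simple i) = 1 := by
        rw [auxN_mul, auxN_simple]; simp [h0]
      obtain ⟨η, hη, e⟩ := cs.exists_isReduced (cs.wordProd ω * cs.simple i)
      rw [e] at this
      have := (cs.isRightInversion_of_mem_rightInvSeq hη (aux_mem cs η _ this)).2
      rw [← e] at this
      simp at this
      omega
    · exact h0
  have hm := aux_mem cs ω _ h1
  obtain ⟨p, hp, e⟩ := List.getElem_of_mem hm
  refine ⟨p, by simpa using hp, ?_⟩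
  rw [← cs.wordProd_mul_getD_rightInvSeq, List.getD_eq_getElem _ _ hp, e]

theorem aux_word_mem (K : Set B) (ω : List B) (h : ∀ i ∈ ω, i ∈ K) :
    cs.wordProd ω ∈ parabolic cs K := by
  induction ω with
  | nil => simp [Subgroup.one_mem]
  | cons i ω ih =>
    rw [cs.wordProd_cons]
    exact Subgroup.mul_mem _ (Subgroup.subset_closure ⟨i, h i (by simp), rfl⟩)
      (ih fun k hk => h k (by simp [hk]))

theorem aux_exists_word (K : Set B) (u : W) (h : u ∈ parabolic cs K) :
    ∃ ω : List B, (∀ i ∈ ω, i ∈ K) ∧ cs.wordProd ω = u := by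
  unfold parabolic at h
  induction h using Subgroup.closure_induction with
  | mem x hx => obtain ⟨i, hi, rfl⟩ := hx; exact ⟨[i], by simpa using hi, by simp⟩
  | one => exact ⟨[], by simp, by simp⟩
  | mul x y _ _ hx hy =>
    obtain ⟨a, ha, rfl⟩ := hx
    obtain ⟨b, hb, rfl⟩ := hy
    refine ⟨a ++ b, ?_, by simp [cs.wordProd_append]⟩
    intro i hi
    rcases List.mem_append.1 hi with h | h
    exacts [ha i h, hb i h]
  | inv x _ hx =>
    obtain ⟨a, ha, rfl⟩ := hx
    exact ⟨a.reverse, by simpa using ha, by simp⟩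

theorem aux_add (K : Set B) (y : W) (hmin : ∀ v ∈ parabolic cs K, cs.length y ≤ cs.length (y * v))
    (ω : List B) (hω : ∀ i ∈ ω, i ∈ K)
    (hmn : ∀ ω' : List B, (∀ i ∈ ω', i ∈ K) → cs.wordProd ω' = cs.wordProd ω →
      ω.length ≤ ω'.length) :
    cs.length (y * cs.wordProd ω) = cs.length y + ω.length := by
  induction ω using List.reverseRecOn with
  | nil => simp
  | append_singleton ω i ih =>
    have hωK : ∀ k ∈ ω, k ∈ K := fun k hk => hω k (by simp [hk])
    have hi : i ∈ K := hω i (by simp)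
    have ih := ih hωK (by
      intro ω' h' e
      have := hmn (ω' ++ [i]) (by
        intro k hk
        rcases List.mem_append.1 hk with h | h
        · exact h' k h
        · simp at h; rwa [h]) (by rw [cs.wordProd_append, cs.wordProd_append, e])
      simpa using this)
    have ew : cs.wordProd (ω ++ [i]) = cs.wordProd ω * cs.simple i := by
      rw [cs.wordProd_append]; simp
    rw [ew, ← mul_assoc]
    rcases cs.length_mul_simple (y * cs.wordProd ω) i with h | h
    · rw [h, ih]; simp; omega
    exfalso
    obtain ⟨η, hη, e⟩ := cs.exists_isReduced y
    have hyw : y * cs.wordProd ω = cs.wordProd (η ++ ω) := by rw [cs.wordProd_append, ← e]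
    rw [hyw] at h
    obtain ⟨p, hp, hpe⟩ := aux_exchange cs (η ++ ω) i (by omega)
    rw [← hyw] at hpe
    by_cases hlt : p < η.length
    · rw [List.eraseIdx_append_of_lt_length hlt, cs.wordProd_append] at hpe
      have hv : cs.wordProd ω * cs.simple i * (cs.wordProd ω)⁻¹ ∈ parabolic cs K := by
        have := aux_word_mem cs K ω hωK
        exact Subgroup.mul_mem _ (Subgroup.mul_mem _ this
          (Subgroup.subset_closure ⟨i, hi, rfl⟩)) (Subgroup.inv_mem _ this)
      have h3 := hmin _ hv
      rw [← mul_assoc, ← mul_assoc, hpe, mul_inv_cancel_right] at h3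
      have h4 := cs.length_wordProd_le (η.eraseIdx p)
      rw [List.length_eraseIdx_of_lt hlt] at h4
      have h5 : cs.length y = η.length := by rw [e]; exact hη
      omega
    · rw [List.eraseIdx_append_of_length_le (by omega), cs.wordProd_append, ← e, mul_assoc,
        mul_right_inj] at hpe
      have := hmn (ω.eraseIdx (p - η.length))
        (fun k hk => hωK k (List.mem_of_mem_eraseIdx hk)) (by rw [ew, hpe])
      rw [List.length_eraseIdx] at this
      simp at this
      split_ifs at this <;> omega

theorem aux_half {V : Type*} [AddCommGroup V] [Module ℝ V] (r : ReflRep cs V) (J K : Set B) (y : W)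
    (hJ : ∀ u ∈ parabolic cs J, y⁻¹ * u * y ∈ parabolic cs K)
    (hmin : ∀ v ∈ parabolic cs K, cs.length y ≤ cs.length (y * v)) :
    ∀ j ∈ J, InNonnegSpan r.α (r.ρ y⁻¹ (r.α j)) ∧
      r.ρ y⁻¹ (r.α j) ∈ Submodule.span ℝ (r.α '' K) := by
  classical
  intro j hj
  have hu := hJ _ (Subgroup.subset_closure ⟨j, hj, rfl⟩)
  have hex : ∃ n, ∃ ω : List B, ω.length = n ∧ (∀ i ∈ ω, i ∈ K) ∧
      cs.wordProd ω = y⁻¹ * cs.simple j * y := by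
    obtain ⟨ω, a, b⟩ := aux_exists_word cs K _ hu
    exact ⟨_, ω, rfl, a, b⟩
  obtain ⟨ω, hn, hωK, hω⟩ := Nat.find_spec hex
  have hadd := aux_add cs K y hmin ω hωK (by
    intro ω' h' e
    rw [hn]
    exact Nat.find_min' hex ⟨ω', rfl, h', by rw [e, hω]⟩)
  have hyω : y * cs.wordProd ω = cs.simple j * y := by rw [hω]; group
  rw [hyω] at hadd
  have hlen : ω.length = 1 := by
    rcases cs.length_simple_mul y j with h | h <;> omega
  obtain ⟨k, rfl⟩ := List.length_eq_one_iff.1 hlen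
  have hk : k ∈ K := hωK k (by simp)
  simp only [cs.wordProd_singleton] at hyω
  have hpos : InNonnegSpan r.α (r.ρ y⁻¹ (r.α j)) := by
    rw [r.pos_iff_length, cs.length_inv, ← cs.length_inv]
    simp [hadd]
  refine ⟨hpos, ?_⟩
  obtain ⟨c, hc, hv⟩ := hpos
  set v := r.ρ y⁻¹ (r.α j) with hvdef
  have hsv : r.ρ (cs.simple k) v = -v := by
    rw [hvdef, ← Module.End.mul_apply, ← map_mul]
    have : cs.simple k * y⁻¹ = y⁻¹ * cs.simple j := by
      rw [mul_inv_eq_iff_eq_mul, mul_assoc, ← hyω]; simp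
    rw [this, map_mul, Module.End.mul_apply, r.refl_simple, map_neg]
  -- positivity of simple images
  have hp : ∀ b, b ≠ k → ∃ d : B →₀ ℝ, (∀ a, 0 ≤ d a) ∧
      r.ρ (cs.simple k) (r.α b) = Finsupp.linearCombination ℝ r.α d := by
    intro b hb
    have : InNonnegSpan r.α (r.ρ (cs.simple k) (r.α b)) := by
      rw [r.pos_iff_length]
      rcases cs.length_mul_simple (cs.simple k) b with h | h
      · exact h
      · exfalso
        rw [cs.length_simple] at h
        have h0 : cs.length (cs.simple k * cs.simple b) = 0 := by omega
        rw [cs.length_eq_zero_iff, mul_eq_one_iff_eq_inv, cs.inv_simple] at h0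
        exact hb (aux_simple_injective cs h0).symm
    exact this
  let bas := Module.Basis.mk r.indep (by rw [r.spans])
  have hbas : ∀ b, bas b = r.α b := fun b => by simp [bas]
  have hrep : ∀ d : B →₀ ℝ, bas.repr (Finsupp.linearCombination ℝ r.α d) = d := by
    intro d
    have : r.α = bas := by funext b; exact (hbas b).symm
    rw [this]; exact bas.repr_linearCombination d
  have hv' : v = Finsupp.linearCombination ℝ r.α c := hv
  have hnn : ∀ b a, b ≠ k → 0 ≤ bas.repr (r.ρ (cs.simple k) (r.α b)) a := by
    intro b a hb
    obtain ⟨d, hd, e⟩ := hp b hb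
    rw [e, hrep]; exact hd a
  -- coefficients vanish
  have hco : ∀ a, a ≠ k → ∀ b ∈ c.support, b ≠ k →
      bas.repr (r.ρ (cs.simple k) (r.α b)) a = 0 := by
    intro a ha
    have h1 : ∑ b ∈ c.support, c b * bas.repr (r.ρ (cs.simple k) (r.α b)) a = - c a := by
      have := congrArg (fun z => bas.repr z a) hsv
      simp only [map_neg, hv', hrep, Finsupp.neg_apply] at this
      rw [← this, Finsupp.linearCombination_apply, Finsupp.sum]
      simp
    have h2 : ∀ b ∈ c.support, 0 ≤ c b * bas.repr (r.ρ (cs.simple k) (r.α b)) a := by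
      intro b _
      by_cases hb : b = k
      · subst hb
        rw [r.refl_simple, ← hbas]
        simp [Finsupp.single_apply, Ne.symm ha]
      · exact mul_nonneg (hc b) (hnn b a hb)
    have h3 : ∑ b ∈ c.support, c b * bas.repr (r.ρ (cs.simple k) (r.α b)) a = 0 :=
      le_antisymm (by rw [h1]; linarith [hc a]) (Finset.sum_nonneg h2)
    intro b hb hbk
    have := (Finset.sum_eq_zero_iff_of_nonneg h2).1 h3 b hb
    exact (mul_eq_zero.1 this).resolve_left (Finsupp.mem_support_iff.1 hb)
  have hsupp : ∀ b ∈ c.support, b = k := by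
    intro b hb
    by_contra hbk
    have h1 : r.ρ (cs.simple k) (r.α b) =
        (bas.repr (r.ρ (cs.simple k) (r.α b)) k) • r.α k := by
      apply bas.repr.injective
      ext a
      by_cases ha : a = k
      · subst ha; rw [← hbas a]; simp
      · rw [hco a ha b hb hbk, ← hbas k]; simp [Finsupp.single_apply, Ne.symm ha]
    have h2 := congrArg (r.ρ (cs.simple k)) h1
    rw [← Module.End.mul_apply, ← map_mul, cs.simple_mul_simple_self, map_one, map_smul,
      r.refl_simple] at h2
    have h3 := congrArg (fun z => bas.repr z b) h2
    simp only [← hbas, Module.End.one_apply] at h3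
    simp [Finsupp.single_apply, Ne.symm hbk] at h3
  rw [hv]
  refine Submodule.sum_mem _ fun b hb => Submodule.smul_mem _ _ (Submodule.subset_span ?_)
  exact ⟨b, by rw [hsupp b hb]; exact hk, rfl⟩

end exch

/-- If `y` has minimal length in the coset `y W_K` and `W_J y = y W_K`, then for
every `j ∈ J`, `y⁻¹ · α_j` is a positive root lying in the span of `{α_k : k ∈ K}`, and for every
`k ∈ K`, `y · α_k` is a positive root lying in the span of `{α_j : j ∈ J}`. -/
theorem minimal_double_coset_rep_positivity {B W V : Type*} [Group W]
    [AddCommGroup V] [Module ℝ V] {M : CoxeterMatrix B} (cs : CoxeterSystem M W)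
    (r : ReflRep cs V) (J K : Set B) (y : W)
    (hcoset : (· * y) '' (parabolic cs J : Set W) = (y * ·) '' (parabolic cs K : Set W))
    (hmin : ∀ v ∈ parabolic cs K, cs.length y ≤ cs.length (y * v)) :
    (∀ j ∈ J, InNonnegSpan r.α (r.ρ y⁻¹ (r.α j)) ∧
      r.ρ y⁻¹ (r.α j) ∈ Submodule.span ℝ (r.α '' K)) ∧
    (∀ k ∈ K, InNonnegSpan r.α (r.ρ y (r.α k)) ∧
      r.ρ y (r.α k) ∈ Submodule.span ℝ (r.α '' J)) := by
  have h1 : ∀ u ∈ parabolic cs J, y⁻¹ * u * y ∈ parabolic cs K := by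
    intro u hu
    have : u * y ∈ (y * ·) '' (parabolic cs K : Set W) := hcoset ▸ ⟨u, hu, rfl⟩
    obtain ⟨v, hv, e⟩ := this
    simp only at e
    rw [mul_assoc, ← e, inv_mul_cancel_left]
    exact hv
  have h2 : ∀ v ∈ parabolic cs K, y * v * y⁻¹ ∈ parabolic cs J := by
    intro v hv
    have : y * v ∈ (· * y) '' (parabolic cs J : Set W) := hcoset ▸ ⟨v, hv, rfl⟩
    obtain ⟨u, hu, e⟩ := this
    simp only at e
    rw [← e, mul_inv_cancel_right]
    exact hu
  refine ⟨aux_half cs r J K y h1 hmin, ?_⟩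
  have := aux_half cs r K J y⁻¹ (by simpa using h2) (by
    intro u hu
    rw [cs.length_inv, ← cs.length_inv (y⁻¹ * u)]
    have h3 := hmin _ (h1 _ (Subgroup.inv_mem _ hu))
    have e : y * (y⁻¹ * u⁻¹ * y) = (y⁻¹ * u)⁻¹ := by group
    rwa [e] at h3)
  simpa using this
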